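/- arXiv:1911.08840 — 2 statements merged into one kernel-verified Lean document; each statement's English description precedes it below -/
import Mathlib

section
/- Let A be an m×n real matrix with m < n. Let x ∈ ℝⁿ be a sparse vector with support N = (T ∪ Δ) \ Δₑ, where T ⊆ {1,…,n} is a known set with |T| = k, Δ ⊆ {1,…,n} is disjoint from T with |Δ| = u, and Δₑ ⊆ T; let s = |N| and put y := Ax. Denote by δ_j the j-th restricted isometry constant of A and by θ_{a,b} the (a,b)-restricted orthogonality constant of A, and define ρ_k(a,b) := (θ_{b,a} + θ_{b,k}·θ_{a,k}/(1−δ_k)) / (1 − δ_a − θ_{a,k}²/(1−δ_k)). If (1) δ_{k+u} < 1 and δ_{2u} + δ_k + θ_{k,2u}² < 1, and (2) ρ_k(2u,u) + ρ_k(u,u) < 1, then x is the unique minimizer of ‖z_{T^c}‖₁ subject to Az = y: every z ∈ ℝⁿ with Az = y and z ≠ x satisfies ‖z_{T^c}‖₁ > ‖x_{T^c}‖₁. -/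
open Classical Finset

/-- The 0-norm: number of nonzero components of a vector. -/
noncomputable def norm0 {n : ℕ} (z : Fin n → ℝ) : ℕ :=
  (Finset.univ.filter fun i => z i ≠ 0).card

/-- The 1-norm of a vector. -/
noncomputable def norm1 {n : ℕ} (z : Fin n → ℝ) : ℝ := ∑ i, |z i|

/-- `δ` satisfies the `k`-restricted isometry inequality for `A`. -/
def RIPineq {m n : ℕ} (A : Matrix (Fin m) (Fin n) ℝ) (k : ℕ) (δ : ℝ) : Prop :=
  ∀ z : Fin n → ℝ, norm0 z ≤ k →
    (1 - δ) * (∑ i, z i ^ 2) ≤ ∑ j, (A.mulVec z j) ^ 2 ∧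
      ∑ j, (A.mulVec z j) ^ 2 ≤ (1 + δ) * (∑ i, z i ^ 2)

/-- `θ` satisfies the `(s,s')`-restricted orthogonality inequality for `A`. -/
def ROineq {m n : ℕ} (A : Matrix (Fin m) (Fin n) ℝ) (s s' : ℕ) (θ : ℝ) : Prop :=
  ∀ u v : Fin n → ℝ, (∀ i, u i = 0 ∨ v i = 0) → norm0 u ≤ s → norm0 v ≤ s' →
    |∑ j, A.mulVec u j * A.mulVec v j| ≤
      θ * Real.sqrt (∑ i, u i ^ 2) * Real.sqrt (∑ i, v i ^ 2)

/-- The restriction of `z` to the index set `S` (zero outside `S`). -/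
noncomputable def restrict {n : ℕ} (z : Fin n → ℝ) (S : Finset (Fin n)) : Fin n → ℝ :=
  fun i => if i ∈ S then z i else 0

/-- The `j`-th restricted isometry constant of `A`. -/
noncomputable def ric {m n : ℕ} (A : Matrix (Fin m) (Fin n) ℝ) (j : ℕ) : ℝ :=
  sInf {δ : ℝ | 0 ≤ δ ∧ RIPineq A j δ}

/-- The `(a,b)`-restricted orthogonality constant of `A`. -/
noncomputable def roc {m n : ℕ} (A : Matrix (Fin m) (Fin n) ℝ) (a b : ℕ) : ℝ :=
  sInf {θ : ℝ | 0 ≤ θ ∧ ROineq A a b θ}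

/-- The quantity `ρ_k(a,b)` from Vaswani et al. -/
noncomputable def rho {m n : ℕ} (A : Matrix (Fin m) (Fin n) ℝ) (k a b : ℕ) : ℝ :=
  (roc A b a + roc A b k * roc A a k / (1 - ric A k)) /
    (1 - ric A a - (roc A a k) ^ 2 / (1 - ric A k))


/-- Euclidean norm. -/
noncomputable def nrmE {n : ℕ} (p : Fin n → ℝ) : ℝ := Real.sqrt (∑ i, p i ^ 2)

/-- The bilinear form `⟨A p, A q⟩`. -/
noncomputable def bilA {m n : ℕ} (A : Matrix (Fin m) (Fin n) ℝ) (p q : Fin n → ℝ) : ℝ :=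
  ∑ j, A.mulVec p j * A.mulVec q j

lemma nrmE_nonneg {n : ℕ} (p : Fin n → ℝ) : 0 ≤ nrmE p := Real.sqrt_nonneg _

lemma nrmE_sq {n : ℕ} (p : Fin n → ℝ) : nrmE p ^ 2 = ∑ i, p i ^ 2 :=
  Real.sq_sqrt (Finset.sum_nonneg fun i _ => sq_nonneg _)

lemma nrmE_eq_zero {n : ℕ} (p : Fin n → ℝ) (h : nrmE p = 0) : p = 0 := by
  have h1 := nrmE_sq p
  rw [h] at h1
  have h2 : ∑ i, p i ^ 2 = 0 := by rw [← h1]; norm_num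
  rw [Finset.sum_eq_zero_iff_of_nonneg (fun i _ => sq_nonneg _)] at h2
  funext i
  simpa using h2 i (Finset.mem_univ i)

lemma bilA_add_right {m n : ℕ} (A : Matrix (Fin m) (Fin n) ℝ) (p q r : Fin n → ℝ) :
    bilA A p (q + r) = bilA A p q + bilA A p r := by
  simp only [bilA, Matrix.mulVec_add, Pi.add_apply, mul_add, Finset.sum_add_distrib]

lemma bilA_comm {m n : ℕ} (A : Matrix (Fin m) (Fin n) ℝ) (p q : Fin n → ℝ) :
    bilA A p q = bilA A q p := by
  simp only [bilA, mul_comm]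

lemma bilA_sub_left {m n : ℕ} (A : Matrix (Fin m) (Fin n) ℝ) (p q r : Fin n → ℝ) :
    bilA A (p - q) r = bilA A p r - bilA A q r := by
  simp only [bilA, Matrix.mulVec_sub, Pi.sub_apply, sub_mul, Finset.sum_sub_distrib]

lemma opBound {m n : ℕ} (A : Matrix (Fin m) (Fin n) ℝ) (z : Fin n → ℝ) :
    ∑ j, (A.mulVec z j) ^ 2 ≤ (∑ j, ∑ i, A j i ^ 2) * ∑ i, z i ^ 2 := by
  rw [Finset.sum_mul]
  refine Finset.sum_le_sum fun j _ => ?_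
  exact Finset.sum_mul_sq_le_sq_mul_sq Finset.univ (A j) z

lemma ric_set_nonempty {m n : ℕ} (A : Matrix (Fin m) (Fin n) ℝ) (j : ℕ) :
    {δ : ℝ | 0 ≤ δ ∧ RIPineq A j δ}.Nonempty := by
  have hC : 0 ≤ ∑ j, ∑ i, A j i ^ 2 :=
    Finset.sum_nonneg fun j _ => Finset.sum_nonneg fun i _ => sq_nonneg _
  refine ⟨1 + ∑ j, ∑ i, A j i ^ 2, by linarith, ?_⟩
  intro z _
  have hz : 0 ≤ ∑ i, z i ^ 2 := Finset.sum_nonneg fun i _ => sq_nonneg _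
  have h1 := opBound A z
  have h0 : 0 ≤ ∑ j, (A.mulVec z j) ^ 2 := Finset.sum_nonneg fun i _ => sq_nonneg _
  constructor
  · nlinarith [mul_nonneg hC hz]
  · nlinarith

lemma roc_set_nonempty {m n : ℕ} (A : Matrix (Fin m) (Fin n) ℝ) (a b : ℕ) :
    {θ : ℝ | 0 ≤ θ ∧ ROineq A a b θ}.Nonempty := by
  have hC : 0 ≤ ∑ j, ∑ i, A j i ^ 2 :=
    Finset.sum_nonneg fun j _ => Finset.sum_nonneg fun i _ => sq_nonneg _
  refine ⟨∑ j, ∑ i, A j i ^ 2, hC, ?_⟩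
  intro p q _ _ _
  refine abs_le_of_sq_le_sq (?_ : _ ≤ _) (by positivity)
  refine (Finset.sum_mul_sq_le_sq_mul_sq _ _ _).trans ?_
  rw [mul_pow, mul_pow, Real.sq_sqrt (Finset.sum_nonneg fun i _ => sq_nonneg _),
    Real.sq_sqrt (Finset.sum_nonneg fun i _ => sq_nonneg _)]
  calc _ ≤ ((∑ j, ∑ i, A j i ^ 2) * ∑ i, p i ^ 2) * ((∑ j, ∑ i, A j i ^ 2) * ∑ i, q i ^ 2) :=
        mul_le_mul (opBound A p) (opBound A q) (by positivity) (by positivity)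
    _ = _ := by ring

lemma ric_nonneg {m n : ℕ} (A : Matrix (Fin m) (Fin n) ℝ) (j : ℕ) : 0 ≤ ric A j :=
  Real.sInf_nonneg fun _ h => h.1

lemma roc_nonneg {m n : ℕ} (A : Matrix (Fin m) (Fin n) ℝ) (a b : ℕ) : 0 ≤ roc A a b :=
  Real.sInf_nonneg fun _ h => h.1

lemma ric_lower {m n : ℕ} (A : Matrix (Fin m) (Fin n) ℝ) (j : ℕ) (z : Fin n → ℝ)
    (hz : norm0 z ≤ j) : (1 - ric A j) * nrmE z ^ 2 ≤ bilA A z z := by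
  rw [nrmE_sq]
  have hB : bilA A z z = ∑ j, (A.mulVec z j) ^ 2 := by simp only [bilA, sq]
  rw [hB]
  have hn : 0 ≤ ∑ i, z i ^ 2 := Finset.sum_nonneg fun i _ => sq_nonneg _
  refine le_of_forall_pos_le_add fun ε hε => ?_
  have hpos : 0 < ε / (1 + ∑ i, z i ^ 2) := by positivity
  obtain ⟨δ, hδ, hlt⟩ := Real.lt_sInf_add_pos (ric_set_nonempty A j) hpos
  have h1 := (hδ.2 z hz).1
  have h2 : δ < ric A j + ε / (1 + ∑ i, z i ^ 2) := hlt
  have h3 : ε / (1 + ∑ i, z i ^ 2) * (∑ i, z i ^ 2) ≤ ε := by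
    rw [div_mul_eq_mul_div, div_le_iff₀ (by positivity)]
    nlinarith
  nlinarith

lemma roc_bound {m n : ℕ} (A : Matrix (Fin m) (Fin n) ℝ) (a b : ℕ) (p q : Fin n → ℝ)
    (hd : ∀ i, p i = 0 ∨ q i = 0) (hp : norm0 p ≤ a) (hq : norm0 q ≤ b) :
    |bilA A p q| ≤ roc A a b * nrmE p * nrmE q := by
  have hn : 0 ≤ nrmE p * nrmE q := mul_nonneg (nrmE_nonneg p) (nrmE_nonneg q)
  refine le_of_forall_pos_le_add fun ε hε => ?_
  have hpos : 0 < ε / (1 + nrmE p * nrmE q) := by positivity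
  obtain ⟨θ, hθ, hlt⟩ := Real.lt_sInf_add_pos (roc_set_nonempty A a b) hpos
  have h1 : |bilA A p q| ≤ θ * nrmE p * nrmE q := hθ.2 p q hd hp hq
  have h2 : θ < roc A a b + ε / (1 + nrmE p * nrmE q) := hlt
  have h3 : ε / (1 + nrmE p * nrmE q) * (nrmE p * nrmE q) ≤ ε := by
    rw [div_mul_eq_mul_div, div_le_iff₀ (by positivity)]
    nlinarith
  nlinarith

lemma ric_mono {m n : ℕ} (A : Matrix (Fin m) (Fin n) ℝ) {i j : ℕ} (h : i ≤ j) :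
    ric A i ≤ ric A j :=
  csInf_le_csInf ⟨0, fun _ h => h.1⟩ (ric_set_nonempty A j)
    fun _ hd => ⟨hd.1, fun z hz => hd.2 z (hz.trans h)⟩

lemma roc_mono {m n : ℕ} (A : Matrix (Fin m) (Fin n) ℝ) {a a' : ℕ} (b : ℕ) (h : a ≤ a') :
    roc A a b ≤ roc A a' b :=
  csInf_le_csInf ⟨0, fun _ h => h.1⟩ (roc_set_nonempty A a' b)
    fun _ hd => ⟨hd.1, fun p q hpq hp hq => hd.2 p q hpq (hp.trans h) hq⟩

lemma roc_le_symm {m n : ℕ} (A : Matrix (Fin m) (Fin n) ℝ) (a b : ℕ) :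
    roc A a b ≤ roc A b a := by
  refine csInf_le_csInf ⟨0, fun _ h => h.1⟩ (roc_set_nonempty A b a)
    fun θ hd => ⟨hd.1, fun p q hpq hp hq => ?_⟩
  have h1 := hd.2 q p (fun i => (hpq i).symm) hq hp
  have h2 : ∑ j, A.mulVec p j * A.mulVec q j = ∑ j, A.mulVec q j * A.mulVec p j :=
    bilA_comm A p q
  rw [h2]
  calc _ ≤ _ := h1
    _ = _ := by ring

lemma norm0_restrict {n : ℕ} (z : Fin n → ℝ) (S : Finset (Fin n)) :
    norm0 (restrict z S) ≤ S.card := by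
  refine Finset.card_le_card fun i hi => ?_
  by_contra h
  simp [_root_.restrict, h] at hi

lemma restrict_union {n : ℕ} (z : Fin n → ℝ) (S S' : Finset (Fin n)) (h : Disjoint S S') :
    restrict z (S ∪ S') = restrict z S + restrict z S' := by
  funext i
  have := fun hi : i ∈ S => Finset.disjoint_left.mp h hi
  simp only [_root_.restrict, Pi.add_apply, Finset.mem_union]
  by_cases h1 : i ∈ S <;> by_cases h2 : i ∈ S' <;> simp_all

lemma norm1_restrict {n : ℕ} (z : Fin n → ℝ) (S : Finset (Fin n)) :
    norm1 (restrict z S) = ∑ i ∈ S, |z i| := by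
  simp only [norm1, _root_.restrict, apply_ite abs, abs_zero, Finset.sum_ite_mem, Finset.univ_inter]

lemma nrmE_restrict_sq {n : ℕ} (z : Fin n → ℝ) (S : Finset (Fin n)) :
    nrmE (restrict z S) ^ 2 = ∑ i ∈ S, z i ^ 2 := by
  rw [nrmE_sq]
  simp only [_root_.restrict, ite_pow]
  simp [Finset.sum_ite_mem]

lemma exists_top {n : ℕ} (f : Fin n → ℝ) (S : Finset (Fin n)) (u : ℕ) (hu : u ≤ S.card) :
    ∃ D ⊆ S, D.card = u ∧ ∀ i ∈ D, ∀ j ∈ S \ D, f j ≤ f i := by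
  induction u with
  | zero => exact ⟨∅, by simp, by simp, by simp⟩
  | succ u ih =>
    obtain ⟨D, hDS, hc, hD⟩ := ih (by omega)
    have hne : (S \ D).Nonempty := by
      rw [← Finset.card_pos, Finset.card_sdiff_of_subset hDS]; omega
    obtain ⟨a, ha, hmax⟩ := Finset.exists_max_image (S \ D) f hne
    have ha' := Finset.mem_sdiff.mp ha
    refine ⟨insert a D, ?_, ?_, ?_⟩
    · exact Finset.insert_subset ha'.1 hDS
    · rw [Finset.card_insert_of_notMem ha'.2, hc]
    · intro i hi j hj
      have hj' : j ∈ S \ D := by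
        simp only [Finset.mem_sdiff, Finset.mem_insert, not_or] at hj ⊢
        exact ⟨hj.1, hj.2.2⟩
      rcases Finset.mem_insert.mp hi with rfl | hi
      · exact hmax j hj'
      · exact hD i hi j hj'

lemma exists_top_level {n : ℕ} (w : Fin n → ℝ) (S : Finset (Fin n)) (u : ℕ) (hu : 1 ≤ u) :
    ∃ D ⊆ S, D.card ≤ u ∧ (u ≤ S.card → D.card = u) ∧ ∃ M : ℝ, 0 ≤ M ∧
      (u : ℝ) * M ≤ ∑ i ∈ D, |w i| ∧ ∀ j ∈ S \ D, |w j| ≤ M := by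
  by_cases h : u ≤ S.card
  · obtain ⟨D, hDS, hc, hD⟩ := exists_top (fun i => |w i|) S u h
    have hne : D.Nonempty := by rw [← Finset.card_pos]; omega
    obtain ⟨a, ha, hmin⟩ := Finset.exists_min_image D (fun i => |w i|) hne
    refine ⟨D, hDS, hc.le, fun _ => hc, |w a|, abs_nonneg _, ?_, fun j hj => hD a ha j hj⟩
    have := Finset.card_nsmul_le_sum D (fun i => |w i|) |w a| hmin
    rw [hc, nsmul_eq_mul] at this
    exact this
  · exact ⟨S, subset_rfl, by omega, fun h' => absurd h' h, 0, le_rfl,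
      by simpa using Finset.sum_nonneg fun i _ => abs_nonneg _, by simp⟩

lemma nrmE_restrict_le {n : ℕ} (w : Fin n → ℝ) (E : Finset (Fin n)) (u : ℕ) (hE : E.card ≤ u)
    (M : ℝ) (hM : 0 ≤ M) (h : ∀ i ∈ E, |w i| ≤ M) :
    nrmE (restrict w E) ≤ Real.sqrt u * M := by
  refine le_of_sq_le_sq ?_ (by positivity)
  rw [nrmE_restrict_sq, mul_pow, Real.sq_sqrt (by positivity)]
  calc ∑ i ∈ E, w i ^ 2 ≤ ∑ i ∈ E, M ^ 2 := Finset.sum_le_sum fun i hi => by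
        rw [← sq_abs]; exact pow_le_pow_left₀ (abs_nonneg _) (h i hi) 2
    _ = (E.card : ℝ) * M ^ 2 := by simp
    _ ≤ _ := by gcongr

lemma block_bound {n : ℕ} (w : Fin n → ℝ) (u : ℕ) (hu : 1 ≤ u) (F : (Fin n → ℝ) → ℝ)
    (hF : ∀ p q, F (p + q) = F p + F q) (K : ℝ) (hK : 0 ≤ K) (c : ℕ) :
    ∀ (S : Finset (Fin n)), S.card ≤ c →
    (∀ E ⊆ S, E.card ≤ u → |F (restrict w E)| ≤ K * nrmE (restrict w E)) →
    ∀ M : ℝ, 0 ≤ M → (∀ i ∈ S, |w i| ≤ M) →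
    |F (restrict w S)| ≤ K * (Real.sqrt u * M + (∑ i ∈ S, |w i|) / Real.sqrt u) := by
  have hs : 0 < Real.sqrt u := Real.sqrt_pos.mpr (by exact_mod_cast hu)
  have hss : Real.sqrt u * Real.sqrt u = u := Real.mul_self_sqrt (by positivity)
  induction c with
  | zero =>
    intro S hS hb M hM hw
    have h1 := hb S subset_rfl (by omega)
    have h2 := nrmE_restrict_le w S u (by omega) M hM hw
    have h3 : 0 ≤ (∑ i ∈ S, |w i|) / Real.sqrt u := by positivity
    exact h1.trans (by gcongr; linarith)
  | succ c ih =>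
    intro S hS hb M hM hw
    by_cases hle : S.card ≤ u
    · have h1 := hb S subset_rfl hle
      have h2 := nrmE_restrict_le w S u hle M hM hw
      have h3 : 0 ≤ (∑ i ∈ S, |w i|) / Real.sqrt u := by positivity
      exact h1.trans (by gcongr; linarith)
    · obtain ⟨D, hDS, hDu, hDu', M', hM', hD1, hD2⟩ := exists_top_level w S u hu
      have hDc := hDu' (by omega)
      have hcard : (S \ D).card ≤ c := by
        rw [Finset.card_sdiff_of_subset hDS]; omega
      have h1 := ih (S \ D) hcard
        (fun E hE hEu => hb E (hE.trans Finset.sdiff_subset) hEu) M' hM' hD2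
      have h2 := hb D hDS hDu
      have h3 := nrmE_restrict_le w D u hDu M hM (fun i hi => hw i (hDS hi))
      have h4 : restrict w S = restrict w D + restrict w (S \ D) := by
        rw [← restrict_union _ _ _ Finset.disjoint_sdiff, Finset.union_sdiff_of_subset hDS]
      have h5 : ∑ i ∈ S, |w i| = ∑ i ∈ S \ D, |w i| + ∑ i ∈ D, |w i| :=
        (Finset.sum_sdiff hDS).symm
      have h6 : Real.sqrt u * M' ≤ (∑ i ∈ D, |w i|) / Real.sqrt u := by
        rw [le_div_iff₀ hs]; nlinarith
      rw [h4, hF, h5, add_div]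
      refine (abs_add_le _ _).trans ?_
      have h7 : |F (restrict w D)| ≤ K * (Real.sqrt u * M) := h2.trans (by gcongr)
      have h8 := mul_le_mul_of_nonneg_left h6 hK
      linarith

/-- Existence of a least squares solution supported on `T`. -/
lemma exists_lsq {m n : ℕ} (A : Matrix (Fin m) (Fin n) ℝ) (T : Finset (Fin n)) (g : Fin n → ℝ) :
    ∃ τ : Fin n → ℝ, ∀ w : Fin n → ℝ,
      bilA A (g - restrict τ T) (restrict w T) = 0 := by
  let R : (Fin n → ℝ) →ₗ[ℝ] (Fin n → ℝ) :=
    { toFun := fun w => restrict w T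
      map_add' := fun p q => by funext i; simp [_root_.restrict]; split_ifs <;> simp
      map_smul' := fun c p => by funext i; simp [_root_.restrict] }
  let f : (Fin n → ℝ) →ₗ[ℝ] EuclideanSpace ℝ (Fin m) :=
    (WithLp.linearEquiv 2 ℝ (Fin m → ℝ)).symm.toLinearMap ∘ₗ A.mulVecLin ∘ₗ R
  let b : EuclideanSpace ℝ (Fin m) := WithLp.toLp 2 (A.mulVec g)
  obtain ⟨τ, hτ⟩ := ((LinearMap.range f).starProjection_apply_mem b)
  refine ⟨τ, fun w => ?_⟩
  have h1 := (LinearMap.range f).starProjection_inner_eq_zero b (f w) ⟨w, rfl⟩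
  rw [← hτ] at h1
  simp only [PiLp.inner_apply] at h1
  rw [bilA_sub_left]
  simp only [bilA, ← Finset.sum_sub_distrib, ← sub_mul]
  rw [← h1]
  refine Finset.sum_congr rfl fun j _ => ?_
  simp [f, b, R, mul_comm]

lemma denom_pos {δ δ' θ : ℝ} (h0 : 0 ≤ δ) (h0' : 0 ≤ δ') (hlt : δ' < 1)
    (h : δ + δ' + θ ^ 2 < 1) : 0 < 1 - δ - θ ^ 2 / (1 - δ') := by
  have h1 : 0 < 1 - δ' := by linarith
  have : θ ^ 2 / (1 - δ') < 1 - δ := by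
    rw [div_lt_iff₀ h1]
    nlinarith [mul_nonneg h0 h0']
  linarith

lemma restrict_disj {n : ℕ} (p q : Fin n → ℝ) (S S' : Finset (Fin n)) (h : Disjoint S S')
    (i : Fin n) : restrict p S i = 0 ∨ restrict q S' i = 0 := by
  have := fun hi : i ∈ S => Finset.disjoint_left.mp h hi
  by_cases h1 : i ∈ S
  · right; simp [_root_.restrict, this h1]
  · left; simp [_root_.restrict, h1]

lemma key_bound {m n : ℕ} (A : Matrix (Fin m) (Fin n) ℝ) (T Δ : Finset (Fin n)) (k u : ℕ)
    (hTk : T.card = k) (hΔu : Δ.card = u) (hdisj : Disjoint T Δ) (hu : 1 ≤ u)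
    (hk : ric A k < 1)
    (hden : 0 < 1 - ric A (2 * u) - (roc A (2 * u) k) ^ 2 / (1 - ric A k))
    (h : Fin n → ℝ) (hA : A.mulVec h = 0) :
    ∑ i ∈ Δ, |h i| ≤ rho A k (2 * u) u * ∑ i ∈ (T ∪ Δ)ᶜ, |h i| := by
  have hs : 0 < Real.sqrt u := Real.sqrt_pos.mpr (by exact_mod_cast hu)
  have hss : Real.sqrt u * Real.sqrt u = u := Real.mul_self_sqrt (by positivity)
  set S : Finset (Fin n) := (T ∪ Δ)ᶜ with hS
  obtain ⟨D, hDS, hDu, -, M, hM, hD1, hD2⟩ := exists_top_level h S u hu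
  have hST : Disjoint S T := by
    rw [Finset.disjoint_left]; intro i hi; simp [hS] at hi; exact hi.1
  have hSΔ : Disjoint S Δ := by
    rw [Finset.disjoint_left]; intro i hi; simp [hS] at hi; exact hi.2
  have hGT : Disjoint (Δ ∪ D) T :=
    Finset.disjoint_union_left.mpr ⟨hdisj.symm, hST.mono_left hDS⟩
  have hEG : ∀ E ⊆ S \ D, Disjoint E (Δ ∪ D) := fun E hE =>
    Finset.disjoint_union_right.mpr ⟨hSΔ.mono_left (hE.trans Finset.sdiff_subset),
      Finset.sdiff_disjoint.mono_left hE⟩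
  have hET : ∀ E ⊆ S \ D, Disjoint E T := fun E hE =>
    hST.mono_left (hE.trans Finset.sdiff_subset)
  set g := restrict h (Δ ∪ D) with hg
  have hg0 : norm0 g ≤ 2 * u :=
    (norm0_restrict _ _).trans ((Finset.card_union_le _ _).trans (by omega))
  obtain ⟨τ0, hτ0⟩ := exists_lsq A T g
  set τ := restrict τ0 T with hτ
  have hτn : norm0 τ ≤ k := (norm0_restrict _ _).trans hTk.le
  have hdec : h = restrict h T + (g + restrict h (S \ D)) := by
    rw [hg, ← restrict_union _ _ _ (hEG _ subset_rfl).symm, ← restrict_union]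
    · funext i
      have : i ∈ T ∪ (Δ ∪ D ∪ S \ D) := by
        simp only [Finset.mem_union, Finset.mem_sdiff, hS, Finset.mem_compl]; tauto
      simp only [_root_.restrict, this, if_true]
    · exact Finset.disjoint_union_right.mpr ⟨hGT.symm, (hET _ subset_rfl).symm⟩
  have hzero : bilA A (g - τ) h = 0 := by simp [bilA, hA]
  have hmain : bilA A (g - τ) g = - bilA A (g - τ) (restrict h (S \ D)) := by
    rw [hdec, bilA_add_right, bilA_add_right, hτ0] at hzero
    linarith
  -- bound on τ
  have hc : 0 < 1 - ric A k := by linarith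
  have hG := nrmE_nonneg g
  have hTT := nrmE_nonneg τ
  have hgτ := roc_bound A (2 * u) k g τ (restrict_disj _ _ _ _ hGT) hg0 hτn
  have hth := roc_nonneg A (2 * u) k
  have hτb : nrmE τ ≤ roc A (2 * u) k / (1 - ric A k) * nrmE g := by
    have h1 := hτ0 τ0
    rw [bilA_sub_left] at h1
    have h2 := ric_lower A k τ hτn
    have h3 := (le_abs_self _).trans hgτ
    rw [div_mul_eq_mul_div, le_div_iff₀ hc]
    rcases hTT.eq_or_lt with h0 | h0
    · rw [← h0]; simp; positivity
    · refine le_of_mul_le_mul_right ?_ h0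
      nlinarith
  have hlow : (1 - ric A (2 * u) - (roc A (2 * u) k) ^ 2 / (1 - ric A k)) * nrmE g ^ 2 ≤
      bilA A (g - τ) g := by
    rw [bilA_sub_left, bilA_comm A τ g]
    have h1 := ric_lower A (2 * u) g hg0
    have h3 := (le_abs_self _).trans hgτ
    have h4 : roc A (2 * u) k * nrmE g * nrmE τ ≤
        roc A (2 * u) k * nrmE g * (roc A (2 * u) k / (1 - ric A k) * nrmE g) := by gcongr
    have h5 : roc A (2 * u) k * nrmE g * (roc A (2 * u) k / (1 - ric A k) * nrmE g) =
        (roc A (2 * u) k) ^ 2 / (1 - ric A k) * nrmE g ^ 2 := by ring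
    nlinarith
  set C := roc A u (2 * u) + roc A u k * roc A (2 * u) k / (1 - ric A k) with hC
  have hC0 : 0 ≤ C := by
    have := roc_nonneg A u (2 * u)
    have := roc_nonneg A u k
    positivity
  have hup := block_bound h u hu (fun p => bilA A (g - τ) p) (fun p q => bilA_add_right A _ p q)
    (C * nrmE g) (mul_nonneg hC0 hG) (S \ D).card (S \ D) le_rfl (by
      intro E hE hEu
      have hEn : norm0 (restrict h E) ≤ u := (norm0_restrict _ _).trans hEu
      have h1 := roc_bound A u (2 * u) (restrict h E) g
        (restrict_disj _ _ _ _ (hEG E hE)) hEn hg0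
      have h2 := roc_bound A u k (restrict h E) τ
        (restrict_disj _ _ _ _ (hET E hE)) hEn hτn
      have h3 := nrmE_nonneg (restrict h E)
      have h4 := roc_nonneg A u k
      have h5 : roc A u k * nrmE (restrict h E) * nrmE τ ≤
        roc A u k * nrmE (restrict h E) * (roc A (2 * u) k / (1 - ric A k) * nrmE g) := by gcongr
      show |bilA A (g - τ) (restrict h E)| ≤ _
      rw [bilA_sub_left, bilA_comm A g, bilA_comm A τ]
      refine (abs_sub _ _).trans ?_
      have h6 : C * nrmE g * nrmE (restrict h E) =
        roc A u (2 * u) * nrmE (restrict h E) * nrmE g +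
        roc A u k * nrmE (restrict h E) * (roc A (2 * u) k / (1 - ric A k) * nrmE g) := by
        rw [hC]; ring
      linarith) M hM hD2
  have hR : Real.sqrt u * M + (∑ i ∈ S \ D, |h i|) / Real.sqrt u ≤
      (∑ i ∈ S, |h i|) / Real.sqrt u := by
    have h5 : ∑ i ∈ S, |h i| = ∑ i ∈ S \ D, |h i| + ∑ i ∈ D, |h i| :=
        (Finset.sum_sdiff hDS).symm
    have h6 : Real.sqrt u * M ≤ (∑ i ∈ D, |h i|) / Real.sqrt u := by
      rw [le_div_iff₀ hs]; nlinarith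
    rw [h5, add_div]; linarith
  have hup2 : bilA A (g - τ) g ≤ C * nrmE g * ((∑ i ∈ S, |h i|) / Real.sqrt u) := by
    rw [hmain]
    refine (neg_le_abs _).trans (hup.trans ?_)
    exact mul_le_mul_of_nonneg_left hR (mul_nonneg hC0 hG)
  have hRn : 0 ≤ (∑ i ∈ S, |h i|) / Real.sqrt u := by positivity
  have hrho : rho A k (2 * u) u =
    C / (1 - ric A (2 * u) - (roc A (2 * u) k) ^ 2 / (1 - ric A k)) := rfl
  have hfin : nrmE g ≤ rho A k (2 * u) u * ((∑ i ∈ S, |h i|) / Real.sqrt u) := by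
    rw [hrho, div_mul_eq_mul_div, le_div_iff₀ hden]
    rcases hG.eq_or_lt with h0 | h0
    · rw [← h0]; simp only [zero_mul]; positivity
    · refine le_of_mul_le_mul_right ?_ h0
      nlinarith
  have hl1 : ∑ i ∈ Δ, |h i| ≤ Real.sqrt u * nrmE g := by
    refine le_of_sq_le_sq ?_ (by positivity)
    rw [mul_pow, Real.sq_sqrt (by positivity), hg, nrmE_restrict_sq, ← hΔu]
    refine (sq_sum_le_card_mul_sum_sq).trans ?_
    refine mul_le_mul_of_nonneg_left ?_ (Nat.cast_nonneg _)
    simp only [sq_abs]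
    exact Finset.sum_le_sum_of_subset_of_nonneg Finset.subset_union_left
      fun i _ _ => sq_nonneg _
  calc _ ≤ _ := hl1
    _ ≤ Real.sqrt u * (rho A k (2 * u) u * ((∑ i ∈ S, |h i|) / Real.sqrt u)) := by gcongr
    _ = _ := by field_simp

lemma nsp {m n : ℕ} (A : Matrix (Fin m) (Fin n) ℝ) (T Δ : Finset (Fin n)) (k u : ℕ)
    (hTk : T.card = k) (hΔu : Δ.card = u) (hdisj : Disjoint T Δ)
    (h1a : ric A (k + u) < 1)
    (h1b : ric A (2 * u) + ric A k + (roc A k (2 * u)) ^ 2 < 1)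
    (h2 : rho A k (2 * u) u + rho A k u u < 1)
    (h : Fin n → ℝ) (hA : A.mulVec h = 0) (hne : h ≠ 0) :
    ∑ i ∈ Δ, |h i| < ∑ i ∈ (T ∪ Δ)ᶜ, |h i| := by
  have hk : ric A k < 1 := (ric_mono A (Nat.le_add_right k u)).trans_lt h1a
  have hsplit : ∑ i ∈ Tᶜ, |h i| = ∑ i ∈ Δ, |h i| + ∑ i ∈ (T ∪ Δ)ᶜ, |h i| := by
    rw [← Finset.sum_union]
    · congr 1
      ext i
      have := fun hi : i ∈ Δ => Finset.disjoint_right.mp hdisj hi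
      simp only [Finset.mem_compl, Finset.mem_union]; tauto
    · rw [Finset.disjoint_left]; intro i hi; simp [hi]
  have hpos : ∑ i ∈ Tᶜ, |h i| ≠ 0 := by
    intro h0
    rw [Finset.sum_eq_zero_iff_of_nonneg (fun i _ => abs_nonneg _)] at h0
    have hr : h = restrict h T := by
      funext i
      by_cases hi : i ∈ T
      · simp [_root_.restrict, hi]
      · have := h0 i (by simpa using hi)
        simpa [_root_.restrict, hi] using this
    have h3 := ric_lower A k h (by rw [hr, ← hTk]; exact norm0_restrict _ _)
    have h4 : bilA A h h = 0 := by simp [bilA, hA]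
    rw [h4] at h3
    apply hne
    apply nrmE_eq_zero
    have h5 : nrmE h ^ 2 ≤ 0 := by
      by_contra hcon
      push Not at hcon
      nlinarith
    nlinarith [nrmE_nonneg h]
  have hΔ0 : 0 ≤ ∑ i ∈ Δ, |h i| := Finset.sum_nonneg fun i _ => abs_nonneg _
  have hS0 : 0 ≤ ∑ i ∈ (T ∪ Δ)ᶜ, |h i| := Finset.sum_nonneg fun i _ => abs_nonneg _
  rcases Nat.eq_zero_or_pos u with hu | hu
  · have : Δ = ∅ := by rw [← Finset.card_eq_zero, hΔu, hu]
    subst this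
    simp only [Finset.sum_empty, zero_add] at hsplit ⊢
    exact lt_of_le_of_ne hS0 (by rw [← hsplit]; exact hpos.symm)
  · have hsym : roc A k (2 * u) = roc A (2 * u) k :=
      le_antisymm (roc_le_symm A _ _) (roc_le_symm A _ _)
    rw [hsym] at h1b
    have hden := denom_pos (ric_nonneg A (2 * u)) (ric_nonneg A k) hk h1b
    have hkey := key_bound A T Δ k u hTk hΔu hdisj hu hk hden h hA
    have hrho : 0 ≤ rho A k u u := by
      have hm := roc_mono A k (show u ≤ 2 * u by omega)
      have hm' := ric_mono A (show u ≤ 2 * u by omega)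
      have h0 := roc_nonneg A u k
      have h0' := roc_nonneg A u u
      have hc : 0 < 1 - ric A k := by linarith
      have hd := denom_pos (θ := roc A u k) (ric_nonneg A u) (ric_nonneg A k) hk (by nlinarith)
      exact div_nonneg (by positivity) hd.le
    rcases hS0.eq_or_lt with h0 | h0
    · rw [← h0, mul_zero] at hkey
      exact absurd (by rw [hsplit, ← h0]; linarith) hpos
    · nlinarith

theorem stmt_4 {m n : ℕ} (A : Matrix (Fin m) (Fin n) ℝ) (hmn : m < n)
    (x : Fin n → ℝ) (N T Δ Δe : Finset (Fin n)) (k u s : ℕ)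
    (hTk : T.card = k) (hΔu : Δ.card = u) (hdisj : Disjoint T Δ) (hΔe : Δe ⊆ T)
    (hNdef : N = (T ∪ Δ) \ Δe) (hNs : N.card = s)
    (hsupp : ∀ i, x i ≠ 0 ↔ i ∈ N)
    (y : Fin m → ℝ) (hy : y = A.mulVec x)
    (h1a : ric A (k + u) < 1)
    (h1b : ric A (2 * u) + ric A k + (roc A k (2 * u)) ^ 2 < 1)
    (h2 : rho A k (2 * u) u + rho A k u u < 1) :
    ∀ z : Fin n → ℝ, A.mulVec z = y → z ≠ x →
      norm1 (restrict x Tᶜ) < norm1 (restrict z Tᶜ) := by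
  intro z hz hzx
  have hne : z - x ≠ 0 := sub_ne_zero.mpr hzx
  have hA : A.mulVec (z - x) = 0 := by rw [Matrix.mulVec_sub, hz, hy, sub_self]
  have hN := nsp A T Δ k u hTk hΔu hdisj h1a h1b h2 (z - x) hA hne
  have hsplit : ∀ f : Fin n → ℝ,
      ∑ i ∈ Tᶜ, |f i| = ∑ i ∈ Δ, |f i| + ∑ i ∈ (T ∪ Δ)ᶜ, |f i| := by
    intro f
    rw [← Finset.sum_union]
    · congr 1
      ext i
      have := fun hi : i ∈ Δ => Finset.disjoint_right.mp hdisj hi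
      simp only [Finset.mem_compl, Finset.mem_union]; tauto
    · rw [Finset.disjoint_left]; intro i hi; simp [hi]
  have hx0 : ∀ i ∈ (T ∪ Δ)ᶜ, x i = 0 := by
    intro i hi
    by_contra hxi
    have := (hsupp i).mp hxi
    rw [hNdef] at this
    exact (Finset.mem_compl.mp hi) (Finset.mem_sdiff.mp this).1
  rw [norm1_restrict, norm1_restrict, hsplit x, hsplit z]
  have e1 : ∑ i ∈ (T ∪ Δ)ᶜ, |x i| = 0 :=
    Finset.sum_eq_zero fun i hi => by rw [hx0 i hi, abs_zero]
  have e2 : ∑ i ∈ (T ∪ Δ)ᶜ, |(z - x) i| = ∑ i ∈ (T ∪ Δ)ᶜ, |z i| :=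
    Finset.sum_congr rfl fun i hi => by rw [Pi.sub_apply, hx0 i hi, sub_zero]
  have e3 : ∑ i ∈ Δ, |x i| ≤ ∑ i ∈ Δ, |z i| + ∑ i ∈ Δ, |(z - x) i| := by
    rw [← Finset.sum_add_distrib]
    refine Finset.sum_le_sum fun i _ => ?_
    have := abs_sub (z i) ((z - x) i)
    simpa using this
  rw [e2] at hN
  linarith
end

section
/- Let A be an m×n real matrix with m < n. Let x ∈ ℝⁿ be a sparse vector with support N = (T ∪ Δ) \ Δₑ, where T ⊆ {1,…,n} is a known set with |T| = k, Δ ⊆ {1,…,n} is disjoint from T with |Δ| = u, and Δₑ ⊆ T. Put y := Ax. If u ≤ k and some δ < 1/5 satisfies the (k+2u)-restricted isometry inequality for A, then x is the unique minimizer of ‖z_{T^c}‖₁ subject to Az = y: every z ∈ ℝⁿ with Az = y and z ≠ x satisfies ‖z_{T^c}‖₁ > ‖x_{T^c}‖₁. -/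
open Classical Finset

lemma aux_top {n : ℕ} (h : Fin n → ℝ) (S : Finset (Fin n)) (u : ℕ) (hu : u ≤ S.card) :
    ∃ B ⊆ S, B.card = u ∧ ∃ b : ℝ, 0 ≤ b ∧ (∀ i ∈ B, b ≤ |h i|) ∧
      ∀ i ∈ S \ B, |h i| ≤ b := by
  induction u with
  | zero =>
    refine ⟨∅, by simp, by simp, ∑ i ∈ S, |h i|, Finset.sum_nonneg fun i _ => abs_nonneg _,
      by simp, ?_⟩
    intro i hi
    exact Finset.single_le_sum (f := fun i => |h i|) (fun i _ => abs_nonneg _)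
      (Finset.mem_sdiff.1 hi).1
  | succ u ih =>
    obtain ⟨B, hBS, hBc, b, hb, h1, h2⟩ := ih (by omega)
    have hne : (S \ B).Nonempty := by
      rw [← Finset.card_pos, Finset.card_sdiff_of_subset hBS]; omega
    obtain ⟨i, hi, hmax⟩ := Finset.exists_max_image (S \ B) (fun i => |h i|) hne
    have hi' := Finset.mem_sdiff.1 hi
    refine ⟨insert i B, ?_, ?_, |h i|, abs_nonneg _, ?_, ?_⟩
    · exact Finset.insert_subset hi'.1 hBS
    · rw [Finset.card_insert_of_notMem hi'.2, hBc]
    · intro j hj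
      rcases Finset.mem_insert.1 hj with rfl | hj
      · exact le_rfl
      · exact (h2 i hi).trans (h1 j hj)
    · intro j hj
      apply hmax
      simp only [Finset.mem_sdiff, Finset.mem_insert, not_or] at hj ⊢
      exact ⟨hj.1, hj.2.2⟩

lemma aux_top' {n : ℕ} (h : Fin n → ℝ) (S : Finset (Fin n)) (u : ℕ) (hu : 0 < u) :
    ∃ B ⊆ S, B.card ≤ u ∧ (S.Nonempty → B.Nonempty) ∧ ∃ b : ℝ, 0 ≤ b ∧
      u * b ≤ ∑ i ∈ B, |h i| ∧ ∀ i ∈ S \ B, |h i| ≤ b := by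
  by_cases hc : u ≤ S.card
  · obtain ⟨B, hBS, hBc, b, hb, h1, h2⟩ := aux_top h S u hc
    refine ⟨B, hBS, hBc.le, fun _ => Finset.card_pos.1 (by omega), b, hb, ?_, h2⟩
    have := Finset.card_nsmul_le_sum B (fun i => |h i|) b h1
    rwa [hBc, nsmul_eq_mul] at this
  · exact ⟨S, subset_rfl, by omega, id, 0, le_rfl, by
      simpa using Finset.sum_nonneg fun i _ => abs_nonneg _, by simp⟩

lemma aux_block {n : ℕ} (h : Fin n → ℝ) (u : ℕ) (hu : 0 < u) (F : Finset (Fin n) → ℝ)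
    (C : ℝ) (hC : 0 ≤ C) (hF : ∀ S B, B ⊆ S → F S = F B + F (S \ B)) (N : ℕ) :
    ∀ (S : Finset (Fin n)) (a : ℝ), S.card ≤ N → 0 ≤ a → (∀ i ∈ S, |h i| ≤ a) →
    (∀ B ⊆ S, B.card ≤ u → |F B| ≤ C * √(∑ i ∈ B, h i ^ 2)) →
    √u * |F S| ≤ C * (u * a + ∑ i ∈ S, |h i|) := by
  have hF0 : F ∅ = 0 := by
    have := hF ∅ ∅ (by simp)
    simp at this; exact this
  induction N with
  | zero =>
    intro S a hS ha _ _
    have : S = ∅ := by simpa using hS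
    subst this
    rw [hF0]; simp; positivity
  | succ N ih =>
    intro S a hS ha hSa hB
    rcases S.eq_empty_or_nonempty with rfl | hne
    · rw [hF0]; simp; positivity
    obtain ⟨B, hBS, hBc, hBne, b, hb, hub, hrest⟩ := aux_top' h S u hu
    have hlt : (S \ B).card ≤ N := by
      rw [Finset.card_sdiff_of_subset hBS]
      have := Finset.card_pos.2 (hBne hne)
      omega
    have h1 := ih (S \ B) b hlt hb hrest
      (fun D hD hDc => hB D (hD.trans Finset.sdiff_subset) hDc)
    have h2 := hB B hBS hBc
    have h3 : √(∑ i ∈ B, h i ^ 2) ≤ √u * a := by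
      rw [Real.sqrt_le_left (by positivity), mul_pow, Real.sq_sqrt (by positivity)]
      calc ∑ i ∈ B, h i ^ 2 ≤ B.card • a ^ 2 := by
            apply Finset.sum_le_card_nsmul
            intro i hi
            rw [← sq_abs]
            exact pow_le_pow_left₀ (abs_nonneg _) (hSa i (hBS hi)) 2
        _ ≤ u * a ^ 2 := by
            rw [nsmul_eq_mul]
            gcongr
    have h4 : √u * |F B| ≤ C * (u * a) := by
      calc √u * |F B| ≤ √u * (C * (√u * a)) := by gcongr; exact h2.trans (by gcongr)
        _ = C * ((√u * √u) * a) := by ring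
        _ = _ := by rw [Real.mul_self_sqrt (by positivity)]
    have h5 : ∑ i ∈ S, |h i| = ∑ i ∈ S \ B, |h i| + ∑ i ∈ B, |h i| :=
      (Finset.sum_sdiff hBS).symm
    have h6 : √u * |F S| ≤ √u * |F B| + √u * |F (S \ B)| := by
      rw [← mul_add, hF S B hBS]; gcongr; exact abs_add_le _ _
    have h7 := mul_le_mul_of_nonneg_left hub hC
    rw [h5]; nlinarith

lemma norm0_restrict_le {n : ℕ} (h : Fin n → ℝ) (S : Finset (Fin n)) :
    norm0 (restrict h S) ≤ S.card := by
  apply Finset.card_le_card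
  intro i hi
  by_contra hn
  simp [_root_.restrict, hn] at hi

lemma sum_restrict_sq {n : ℕ} (h : Fin n → ℝ) (S : Finset (Fin n)) :
    ∑ i, restrict h S i ^ 2 = ∑ i ∈ S, h i ^ 2 := by
  simp [_root_.restrict, ite_pow, Finset.sum_ite_mem]

lemma aux_ip {m n : ℕ} (A : Matrix (Fin m) (Fin n) ℝ) (K : ℕ) (δ : ℝ) (hδ : 0 ≤ δ)
    (hR : RIPineq A K δ) (h : Fin n → ℝ) (P Q : Finset (Fin n)) (hd : Disjoint P Q)
    (hc : P.card + Q.card ≤ K) :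
    |∑ j, A.mulVec (restrict h P) j * A.mulVec (restrict h Q) j| ≤
      δ * √(∑ i ∈ P, h i ^ 2) * √(∑ i ∈ Q, h i ^ 2) := by
  set p := ∑ i ∈ P, h i ^ 2 with hp
  set q := ∑ i ∈ Q, h i ^ 2 with hq
  have hp0 : 0 ≤ p := Finset.sum_nonneg fun i _ => sq_nonneg _
  have hq0 : 0 ≤ q := Finset.sum_nonneg fun i _ => sq_nonneg _
  set I := ∑ j, A.mulVec (restrict h P) j * A.mulVec (restrict h Q) j with hI
  set X := ∑ j, A.mulVec (restrict h P) j ^ 2 with hX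
  set Y := ∑ j, A.mulVec (restrict h Q) j ^ 2 with hY
  have key : ∀ t : ℝ, (1 - δ) * (p + t ^ 2 * q) ≤ X + 2 * t * I + t ^ 2 * Y ∧
      X + 2 * t * I + t ^ 2 * Y ≤ (1 + δ) * (p + t ^ 2 * q) := by
    intro t
    have h0 : norm0 (restrict h P + t • restrict h Q) ≤ K := by
      refine le_trans ?_ hc
      rw [← Finset.card_union_of_disjoint hd]
      apply Finset.card_le_card
      intro i hi
      by_contra hn
      simp only [Finset.mem_union, not_or] at hn
      simp [_root_.restrict, hn.1, hn.2] at hi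
    have h1 : ∑ i, (restrict h P + t • restrict h Q) i ^ 2 = p + t ^ 2 * q := by
      rw [hp, hq, ← sum_restrict_sq h P, ← sum_restrict_sq h Q, Finset.mul_sum, ← Finset.sum_add_distrib]
      refine Finset.sum_congr rfl fun i _ => ?_
      by_cases hi : i ∈ P
      · have := Finset.disjoint_left.1 hd hi
        simp [_root_.restrict, hi, this]
      · simp [_root_.restrict, hi]; split_ifs <;> ring
    have h2 : ∑ j, A.mulVec (restrict h P + t • restrict h Q) j ^ 2
        = X + 2 * t * I + t ^ 2 * Y := by
      rw [hX, hI, hY, Finset.mul_sum, Finset.mul_sum, ← Finset.sum_add_distrib,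
        ← Finset.sum_add_distrib]
      refine Finset.sum_congr rfl fun j _ => ?_
      rw [Matrix.mulVec_add, Matrix.mulVec_smul]
      simp only [Pi.add_apply, Pi.smul_apply, smul_eq_mul]
      ring
    have := hR _ h0
    rwa [h1, h2] at this
  have hdis : discrim (δ * q) (-2 * I) (δ * p) ≤ 0 := by
    apply discrim_le_zero
    intro t
    have a := (key t).1
    have b := (key (-t)).2
    have a' := (key (-t)).1
    have b' := (key (t)).2
    nlinarith
  rw [discrim] at hdis
  apply abs_le_of_sq_le_sq
  · rw [mul_pow, mul_pow, Real.sq_sqrt hp0, Real.sq_sqrt hq0]; nlinarith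
  · positivity

lemma restrict_split {n : ℕ} (h : Fin n → ℝ) (S B : Finset (Fin n)) (hB : B ⊆ S) :
    restrict h S = restrict h B + restrict h (S \ B) := by
  funext i
  by_cases hi : i ∈ B
  · simp [_root_.restrict, hi, hB hi]
  · simp [_root_.restrict, hi]

lemma aux_kernel {m n : ℕ} (A : Matrix (Fin m) (Fin n) ℝ) (T Δ : Finset (Fin n)) (k u : ℕ)
    (hTk : T.card = k) (hΔu : Δ.card = u) (hdisj : Disjoint T Δ) (huk : u ≤ k)
    (δ : ℝ) (hδ0 : 0 ≤ δ) (hδ : δ < 1 / 5) (hRIP : RIPineq A (k + 2 * u) δ)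
    (h : Fin n → ℝ) (hA : A.mulVec h = 0)
    (hle : ∑ i ∈ (T ∪ Δ)ᶜ, |h i| ≤ ∑ i ∈ Δ, |h i|) : h = 0 := by
  -- it suffices that h vanishes on W = T ∪ Δ
  have fin : (∑ i ∈ T ∪ Δ, h i ^ 2 ≤ 0) → h = 0 := by
    intro hz
    have hz' := (Finset.sum_eq_zero_iff_of_nonneg (fun i _ => sq_nonneg (h i))).1
      (le_antisymm hz (Finset.sum_nonneg fun i _ => sq_nonneg _))
    have hΔ0 : ∑ i ∈ Δ, |h i| = 0 := Finset.sum_eq_zero fun i hi => by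
      simpa using hz' i (Finset.mem_union_right _ hi)
    have hc := (Finset.sum_eq_zero_iff_of_nonneg (fun i _ => abs_nonneg (h i))).1
      (le_antisymm (hΔ0 ▸ hle) (Finset.sum_nonneg fun i _ => abs_nonneg _))
    funext i
    by_cases hi : i ∈ T ∪ Δ
    · simpa using hz' i hi
    · simpa using hc i (Finset.mem_compl.2 hi)
  rcases Nat.eq_zero_or_pos u with hu | hu
  · have hΔ : Δ = ∅ := by rw [← Finset.card_eq_zero]; omega
    subst hΔ
    simp only [Finset.union_empty, Finset.sum_empty] at hle fin
    have hc := (Finset.sum_eq_zero_iff_of_nonneg (fun i _ => abs_nonneg (h i))).1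
      (le_antisymm hle (Finset.sum_nonneg fun i _ => abs_nonneg _))
    have hT : restrict h T = h := by
      funext i
      by_cases hi : i ∈ T
      · simp [_root_.restrict, hi]
      · have := hc i (Finset.mem_compl.2 hi)
        simp [_root_.restrict, hi]; simpa [eq_comm] using this
    have := (hRIP (restrict h T) ((norm0_restrict_le h T).trans (by omega))).1
    rw [sum_restrict_sq, hT, hA] at this
    simp only [Pi.zero_apply, ne_eq, OfNat.ofNat_ne_zero, not_false_eq_true, zero_pow,
      Finset.sum_const_zero] at this
    apply fin
    nlinarith
  obtain ⟨B, hBS, hBc, -, b, hb, hub, hrest⟩ := aux_top' h (T ∪ Δ)ᶜ u hu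
  have hdB : Disjoint (T ∪ Δ) B :=
    Finset.disjoint_of_subset_right hBS disjoint_compl_right
  have hTB : Disjoint T B := Finset.disjoint_of_subset_left Finset.subset_union_left hdB
  have hΔB : Disjoint Δ B := Finset.disjoint_of_subset_left Finset.subset_union_right hdB
  set R := (T ∪ Δ)ᶜ \ B with hR
  set E := Δ ∪ B with hE
  have hEc : E.card ≤ 2 * u := by
    have := Finset.card_union_le Δ B; rw [← hE] at this; omega
  have hTE : Disjoint T E := Finset.disjoint_union_right.2 ⟨hdisj, hTB⟩
  have hTR : Disjoint T R := by
    rw [Finset.disjoint_left]; intro i hi; simp [hR, hi]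
  have hER : Disjoint E R := by
    rw [Finset.disjoint_left]; intro i hi
    rcases Finset.mem_union.1 hi with hi | hi <;> simp [hR, hi]
  -- the block estimate
  have blk : ∀ P : Finset (Fin n), Disjoint P R → P.card ≤ k + u →
      √u * |∑ j, A.mulVec (restrict h P) j * A.mulVec (restrict h R) j| ≤
        δ * √(∑ i ∈ P, h i ^ 2) * ∑ i ∈ Δ, |h i| := by
    intro P hPR hPc
    have := aux_block h u hu
      (fun S => ∑ j, A.mulVec (restrict h P) j * A.mulVec (restrict h S) j)
      (δ * √(∑ i ∈ P, h i ^ 2)) (by positivity) (by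
        intro S D hD
        rw [restrict_split h S D hD, Matrix.mulVec_add, ← Finset.sum_add_distrib]
        refine Finset.sum_congr rfl fun j _ => ?_
        rw [Pi.add_apply, mul_add]) R.card R b le_rfl hb hrest (by
        intro D hD hDc
        exact aux_ip A _ δ hδ0 hRIP h P D (Finset.disjoint_of_subset_right hD hPR) (by omega))
    refine this.trans ?_
    gcongr
    have h5 : ∑ i ∈ R, |h i| + ∑ i ∈ B, |h i| = ∑ i ∈ (T ∪ Δ)ᶜ, |h i| := Finset.sum_sdiff hBS
    linarith
  have bT := blk T hTR (by omega)
  have bE := blk E hER (by omega)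
  set s := ∑ i ∈ T ∪ E, h i ^ 2 with hs
  have hs0 : 0 ≤ s := Finset.sum_nonneg fun i _ => sq_nonneg _
  have hsub : ∀ P, P ⊆ T ∪ E → ∑ i ∈ P, h i ^ 2 ≤ s := fun P hP =>
    Finset.sum_le_sum_of_subset_of_nonneg hP fun i _ _ => sq_nonneg _
  have hΔs : ∑ i ∈ Δ, |h i| ≤ √u * √s := by
    rw [← Real.sqrt_mul (by positivity)]
    apply Real.le_sqrt_of_sq_le
    have h1 := sq_sum_le_card_mul_sum_sq (s := Δ) (f := fun i => |h i|)
    simp only [sq_abs, hΔu] at h1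
    refine h1.trans ?_
    gcongr
    exact hsub Δ (Finset.subset_union_left.trans Finset.subset_union_right)
  have hsu : 0 < √(u : ℝ) := Real.sqrt_pos.2 (by exact_mod_cast hu)
  have fin2 : ∀ P, P ⊆ T ∪ E → √u * |∑ j, A.mulVec (restrict h P) j * A.mulVec (restrict h R) j| ≤
        δ * √(∑ i ∈ P, h i ^ 2) * ∑ i ∈ Δ, |h i| →
        |∑ j, A.mulVec (restrict h P) j * A.mulVec (restrict h R) j| ≤ δ * s := by
    intro P hP hb
    have : δ * √(∑ i ∈ P, h i ^ 2) * ∑ i ∈ Δ, |h i| ≤ δ * √s * (√u * √s) := by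
      gcongr
      exact hsub P hP
    have e : δ * √s * (√u * √s) = √u * (δ * s) := by
      rw [show δ * √s * (√u * √s) = √u * (δ * (√s * √s)) by ring, Real.mul_self_sqrt hs0]
    rw [e] at this
    exact le_of_mul_le_mul_left (hb.trans this) hsu
  have cT := abs_le.1 (fin2 T Finset.subset_union_left bT)
  have cE := abs_le.1 (fin2 E Finset.subset_union_right bE)
  have rip := (hRIP (restrict h (T ∪ E)) ((norm0_restrict_le h _).trans (by
    rw [Finset.card_union_of_disjoint hTE]; omega))).1
  rw [sum_restrict_sq, ← hs] at rip
  have d1 : restrict h (T ∪ E) = restrict h T + restrict h E := by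
    rw [restrict_split h (T ∪ E) T Finset.subset_union_left,
      Finset.union_sdiff_cancel_left hTE]
  have d2 : h = restrict h (T ∪ E) + restrict h R := by
    funext i
    by_cases h1 : i ∈ T <;> by_cases h2 : i ∈ Δ <;> by_cases h3 : i ∈ B <;>
      simp [_root_.restrict, hE, hR, h1, h2, h3]
  have d3 : A.mulVec (restrict h (T ∪ E)) = - A.mulVec (restrict h R) := by
    have := hA
    rw [d2, Matrix.mulVec_add] at this
    exact eq_neg_of_add_eq_zero_left this
  have d4 : ∑ j, A.mulVec (restrict h (T ∪ E)) j ^ 2 =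
      -(∑ j, A.mulVec (restrict h T) j * A.mulVec (restrict h R) j)
      - ∑ j, A.mulVec (restrict h E) j * A.mulVec (restrict h R) j := by
    rw [← Finset.sum_neg_distrib, ← Finset.sum_sub_distrib]
    refine Finset.sum_congr rfl fun j _ => ?_
    have e1 : A.mulVec (restrict h (T ∪ E)) j = - A.mulVec (restrict h R) j := by
      rw [d3]; rfl
    have e2 : A.mulVec (restrict h (T ∪ E)) j =
        A.mulVec (restrict h T) j + A.mulVec (restrict h E) j := by
      rw [d1, Matrix.mulVec_add]; rfl
    rw [sq]; nth_rw 1 [e2]; rw [e1]; ring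
  apply fin
  refine (hsub (T ∪ Δ) (Finset.union_subset_union_right Finset.subset_union_left)).trans ?_
  rw [d4] at rip
  nlinarith

theorem stmt_5 {m n : ℕ} (A : Matrix (Fin m) (Fin n) ℝ) (hmn : m < n)
    (x : Fin n → ℝ) (N T Δ Δe : Finset (Fin n)) (k u : ℕ)
    (hTk : T.card = k) (hΔu : Δ.card = u) (hdisj : Disjoint T Δ) (hΔe : Δe ⊆ T)
    (hNdef : N = (T ∪ Δ) \ Δe)
    (hsupp : ∀ i, x i ≠ 0 ↔ i ∈ N)
    (y : Fin m → ℝ) (hy : y = A.mulVec x)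
    (huk : u ≤ k)
    (δ : ℝ) (hδ : δ < 1 / 5) (hRIP : RIPineq A (k + 2 * u) δ) :
    ∀ z : Fin n → ℝ, A.mulVec z = y → z ≠ x →
      norm1 (restrict x Tᶜ) < norm1 (restrict z Tᶜ) := by
  intro z hz hne
  by_contra hcon
  push Not at hcon
  apply hne
  have hRIP' : RIPineq A (k + 2 * u) (max δ 0) := by
    intro w hw
    have h1 := hRIP w hw
    have h0 : 0 ≤ ∑ i, w i ^ 2 := Finset.sum_nonneg fun i _ => sq_nonneg _
    have := le_max_left δ 0
    constructor <;> nlinarith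
  have hn1 : ∀ w : Fin n → ℝ, norm1 (restrict w Tᶜ) =
      ∑ i ∈ (T ∪ Δ)ᶜ, |w i| + ∑ i ∈ Δ, |w i| := by
    intro w
    have hsubs : Δ ⊆ Tᶜ := by
      intro i hi
      exact Finset.mem_compl.2 (Finset.disjoint_right.1 hdisj hi)
    have hsd : Tᶜ \ Δ = (T ∪ Δ)ᶜ := by ext i; simp
    rw [← hsd, Finset.sum_sdiff hsubs]
    simp only [norm1, _root_.restrict, apply_ite abs, abs_zero, Finset.sum_ite_mem, Finset.univ_inter]
  have hx0 : ∀ i ∈ (T ∪ Δ)ᶜ, x i = 0 := by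
    intro i hi
    by_contra hx
    have := (hsupp i).1 hx
    rw [hNdef] at this
    exact (Finset.mem_compl.1 hi) (Finset.mem_sdiff.1 this).1
  have := aux_kernel A T Δ k u hTk hΔu hdisj huk (max δ 0) (le_max_right _ _)
    (max_lt hδ (by norm_num)) hRIP' (z - x) (by rw [Matrix.mulVec_sub, hz, hy, sub_self]) (by
      rw [hn1, hn1] at hcon
      have e1 : ∑ i ∈ (T ∪ Δ)ᶜ, |x i| = 0 := Finset.sum_eq_zero fun i hi => by simp [hx0 i hi]
      have e2 : ∑ i ∈ (T ∪ Δ)ᶜ, |(z - x) i| = ∑ i ∈ (T ∪ Δ)ᶜ, |z i| :=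
        Finset.sum_congr rfl fun i hi => by simp [hx0 i hi]
      have e3 : ∑ i ∈ Δ, |x i| ≤ ∑ i ∈ Δ, |z i| + ∑ i ∈ Δ, |(z - x) i| := by
        rw [← Finset.sum_add_distrib]
        refine Finset.sum_le_sum fun i _ => ?_
        have := abs_sub (z i) (z i - x i)
        simpa using this
      linarith)
  exact sub_eq_zero.1 this
end
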